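/- arXiv:1301.5149 — 2 statements merged into one kernel-verified Lean document; each statement's English description precedes it below -/
import Mathlib

section
/- A minimally imperfect graph that admits a 2-join is an odd hole, i.e. a chordless cycle of odd length at least 5 (Cornuéjols and Cunningham). -/
open SimpleGraph

/-- A graph is perfect if every induced subgraph has chromatic number equal to
its clique number. -/
def IsPerfect {V : Type} (G : SimpleGraph V) : Prop :=
  ∀ s : Set V, (G.induce s).chromaticNumber = ((G.induce s).cliqueNum : ℕ∞)

/-- A graph is minimally imperfect if it is not perfect but all its proper
induced subgraphs are perfect. -/
def MinimallyImperfect {V : Type} (G : SimpleGraph V) : Prop :=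
  ¬ IsPerfect G ∧ ∀ s : Set V, s ≠ Set.univ → IsPerfect (G.induce s)

/-- A 2-join `(X1, X2)` of `G` with split sets `A1, B1 ⊆ X1` and `A2, B2 ⊆ X2`. -/
def IsTwoJoin {V : Type} [Fintype V] [DecidableEq V] (G : SimpleGraph V)
    (X1 X2 A1 B1 A2 B2 : Finset V) : Prop :=
  Disjoint X1 X2 ∧ X1 ∪ X2 = Finset.univ ∧
  A1 ⊆ X1 ∧ B1 ⊆ X1 ∧ A2 ⊆ X2 ∧ B2 ⊆ X2 ∧
  A1.Nonempty ∧ B1.Nonempty ∧ A2.Nonempty ∧ B2.Nonempty ∧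
  Disjoint A1 B1 ∧ Disjoint A2 B2 ∧
  (∀ x ∈ X1, ∀ y ∈ X2, G.Adj x y ↔ ((x ∈ A1 ∧ y ∈ A2) ∨ (x ∈ B1 ∧ y ∈ B2))) ∧
  3 ≤ X1.card ∧ 3 ≤ X2.card ∧
  (∀ v (hv : v ∈ X1),
    (∃ a, ∃ ha : a ∈ X1, a ∈ A1 ∧
      (G.induce (X1 : Set V)).Reachable ⟨v, hv⟩ ⟨a, ha⟩) ∧
    (∃ c, ∃ hc : c ∈ X1, c ∈ B1 ∧
      (G.induce (X1 : Set V)).Reachable ⟨v, hv⟩ ⟨c, hc⟩)) ∧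
  (∀ v (hv : v ∈ X2),
    (∃ a, ∃ ha : a ∈ X2, a ∈ A2 ∧
      (G.induce (X2 : Set V)).Reachable ⟨v, hv⟩ ⟨a, ha⟩) ∧
    (∃ c, ∃ hc : c ∈ X2, c ∈ B2 ∧
      (G.induce (X2 : Set V)).Reachable ⟨v, hv⟩ ⟨c, hc⟩)) ∧
  ¬ (∃ p q r : V, A1 = {p} ∧ B1 = {r} ∧ X1 = {p, q, r} ∧
      p ≠ q ∧ q ≠ r ∧ p ≠ r ∧ G.Adj p q ∧ G.Adj q r ∧ ¬ G.Adj p r) ∧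
  ¬ (∃ p q r : V, A2 = {p} ∧ B2 = {r} ∧ X2 = {p, q, r} ∧
      p ≠ q ∧ q ≠ r ∧ p ≠ r ∧ G.Adj p q ∧ G.Adj q r ∧ ¬ G.Adj p r)

variable {V : Type}

/-- `p 0, …, p n` are consecutive vertices of a walk of `G` inside `S`. -/
def IsWalkSeq (G : SimpleGraph V) (S : Set V) (n : ℕ) (p : ℕ → V) : Prop :=
  (∀ t ≤ n, p t ∈ S) ∧ ∀ t < n, G.Adj (p t) (p (t + 1))

/-- `p 0, …, p n` is a chordless path of `G` inside `S` from `A` to `B`, no interior vertex of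
which lies in `A ∪ B`. -/
structure IsLink (G : SimpleGraph V) (S A B : Set V) (n : ℕ) (p : ℕ → V) : Prop where
  mem : ∀ t ≤ n, p t ∈ S
  start : p 0 ∈ A
  last : p n ∈ B
  adj : ∀ i j, i < j → j ≤ n → (G.Adj (p i) (p j) ↔ j = i + 1)
  inj : ∀ i j, i < j → j ≤ n → p i ≠ p j
  notMem_left : ∀ i, 0 < i → i ≤ n → p i ∉ A
  notMem_right : ∀ i, i < n → p i ∉ B

theorem IsWalkSeq.shortcut {G : SimpleGraph V} {S : Set V} {n : ℕ} {p : ℕ → V}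
    (h : IsWalkSeq G S n p) {i d : ℕ} (hd : i + 1 + d ≤ n) (hadj : G.Adj (p i) (p (i + 1 + d))) :
    IsWalkSeq G S (n - d) (fun t => if t ≤ i then p t else p (t + d)) := by
  refine ⟨fun t ht => ?_, fun t ht => ?_⟩
  · dsimp only
    split_ifs
    · exact h.1 _ (by omega)
    · exact h.1 _ (by omega)
  · dsimp only
    rcases lt_trichotomy t i with h1 | h1 | h1
    · rw [if_pos (by omega), if_pos (by omega)]
      exact h.2 _ (by omega)
    · subst h1
      rw [if_pos le_rfl, if_neg (by omega)]
      exact hadj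
    · rw [if_neg (by omega), if_neg (by omega)]
      have := h.2 (t + d) (by omega)
      rwa [show t + 1 + d = t + d + 1 by ring]

theorem exists_isLink {G : SimpleGraph V} {S A B : Set V}
    (h : ∃ n p, IsWalkSeq G S n p ∧ p 0 ∈ A ∧ p n ∈ B) : ∃ n p, IsLink G S A B n p := by
  classical
  obtain ⟨p, hp, hA, hB⟩ := Nat.find_spec h
  have hmin : ∀ m < Nat.find h, ¬ ∃ p, IsWalkSeq G S m p ∧ p 0 ∈ A ∧ p m ∈ B :=
    fun m hm => Nat.find_min h hm
  generalize Nat.find h = n at hp hA hB hmin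
  have hnB : ∀ i, i < n → p i ∉ B := fun i hi hiB =>
    hmin i hi ⟨p, ⟨fun t ht => hp.1 t (by omega), fun t ht => hp.2 t (by omega)⟩, hA, hiB⟩
  have hnA : ∀ i, 0 < i → i ≤ n → p i ∉ A := by
    intro i hi hin hiA
    refine hmin (n - i) (by omega) ⟨fun t => p (t + i), ⟨fun t ht => hp.1 _ (by omega),
      fun t ht => ?_⟩, by simpa using hiA, by simpa [Nat.sub_add_cancel hin] using hB⟩
    have := hp.2 (t + i) (by omega)
    dsimp only
    rwa [show t + 1 + i = t + i + 1 by ring]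
  have hchord : ∀ i d, 0 < d → i + 1 + d ≤ n → ¬ G.Adj (p i) (p (i + 1 + d)) := by
    intro i d hd hin hadj
    refine hmin (n - d) (by omega) ⟨_, hp.shortcut hin hadj, by simpa using hA, ?_⟩
    rw [if_neg (by omega), Nat.sub_add_cancel (by omega)]
    exact hB
  refine ⟨n, p, hp.1, hA, hB, fun i j hij hj => ⟨fun hadj => ?_, ?_⟩, fun i j hij hj heq => ?_,
    hnA, hnB⟩
  · by_contra hne
    obtain ⟨d, rfl⟩ : ∃ d, j = i + 1 + d := ⟨j - i - 1, by omega⟩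
    exact hchord i d (by omega) hj hadj
  · rintro rfl
    exact hp.2 i (by omega)
  · rcases hj.lt_or_eq with hjn | rfl
    · have hadj := hp.2 j hjn
      rw [← heq] at hadj
      refine hchord i (j - i) (by omega) (by omega) ?_
      rwa [show i + 1 + (j - i) = j + 1 by omega]
    · exact hnB i hij (heq ▸ hB)

/-- A walk between two vertices, as a sequence. -/
theorem exists_isWalkSeq_of_reachable {G : SimpleGraph V} {S : Set V} {u v : S}
    (h : (G.induce S).Reachable u v) :
    ∃ n p, IsWalkSeq G S n p ∧ p 0 = u ∧ p n = v := by
  obtain ⟨w⟩ := h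
  refine ⟨w.length, fun t => (w.getVert t : V), ⟨fun t _ => (w.getVert t).2, fun t ht => ?_⟩,
    by simp, by simp⟩
  exact w.adj_getVert_succ ht

section Kempe

variable {G : SimpleGraph V} {N : ℕ}

theorem IsWalkSeq.color_eq {X : Set V} {c : V → Fin N}
    (hc : ∀ u ∈ X, ∀ v ∈ X, G.Adj u v → c u ≠ c v) {i j : Fin N} {n : ℕ} {p : ℕ → V}
    (hp : IsWalkSeq G {v | v ∈ X ∧ (c v = i ∨ c v = j)} n p) (h0 : c (p 0) = i) :
    ∀ t ≤ n, (Even t → c (p t) = i) ∧ (Odd t → c (p t) = j) := by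
  intro t
  induction t with
  | zero => exact fun _ => ⟨fun _ => h0, fun h => by simp at h⟩
  | succ t ih =>
    intro ht
    obtain ⟨h1, h2⟩ := ih (by omega)
    have hadj := hp.2 t (by omega)
    have hm := hp.1 t (by omega)
    have hm' := hp.1 (t + 1) ht
    have hne := hc _ hm.1 _ hm'.1 hadj
    have := hm'.2
    refine ⟨fun he => ?_, fun ho => ?_⟩
    · have := h2 (by grind)
      grind
    · have := h1 (by grind)
      grind

/-- Kempe interchange of two colours on the components that meet `A`, when none of these
meets `B`. -/
theorem exists_kempe_swap {X A B : Set V} (hAX : A ⊆ X) {c : V → Fin N}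
    (hc : ∀ u ∈ X, ∀ v ∈ X, G.Adj u v → c u ≠ c v) (i j : Fin N)
    (hno : ¬ ∃ n p, IsWalkSeq G {v | v ∈ X ∧ (c v = i ∨ c v = j)} n p ∧ p 0 ∈ A ∧ p n ∈ B) :
    ∃ c' : V → Fin N, (∀ u ∈ X, ∀ v ∈ X, G.Adj u v → c' u ≠ c' v) ∧
      (∀ v ∈ A, c' v = Equiv.swap i j (c v)) ∧ ∀ v ∈ B, c' v = c v := by
  classical
  set S : Set V := {v | v ∈ X ∧ (c v = i ∨ c v = j)} with hS
  let D : Set V := {v | ∃ n p, IsWalkSeq G S n p ∧ p 0 ∈ A ∧ p n = v}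
  have hDS : D ⊆ S := by
    rintro v ⟨n, p, hp, -, rfl⟩
    exact hp.1 n le_rfl
  have hclosed : ∀ u ∈ D, ∀ v ∈ S, G.Adj u v → v ∈ D := by
    rintro u ⟨n, p, hp, h0, rfl⟩ v hv hadj
    refine ⟨n + 1, fun t => if t ≤ n then p t else v, ⟨fun t ht => ?_, fun t ht => ?_⟩,
      by simpa using h0, by simp⟩
    · dsimp only
      split_ifs with h
      · exact hp.1 t h
      · exact hv
    · dsimp only
      rcases (Nat.lt_succ_iff.1 ht).lt_or_eq with h | rfl
      · rw [if_pos (by omega), if_pos (by omega)]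
        exact hp.2 t h
      · rwa [if_pos le_rfl, if_neg (by omega)]
  have hAD : ∀ v ∈ A, v ∈ S → v ∈ D := fun v hv hvS =>
    ⟨0, fun _ => v, ⟨fun _ _ => hvS, fun t ht => by omega⟩, hv, rfl⟩
  have hmix : ∀ u ∈ X, ∀ v ∈ X, G.Adj u v → u ∈ D → v ∉ D →
      Equiv.swap i j (c u) ≠ c v := by
    intro u hu v hv hadj huD hvD heq
    refine hvD (hclosed u huD v ⟨hv, ?_⟩ hadj)
    rcases (hDS huD).2 with h | h <;> rw [← heq, h] <;> simp
  refine ⟨fun v => if v ∈ D then Equiv.swap i j (c v) else c v, fun u hu v hv hadj => ?_,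
    fun v hv => ?_, fun v hv => ?_⟩
  · dsimp only
    split_ifs with h1 h2 h2
    · exact fun h => hc u hu v hv hadj ((Equiv.swap i j).injective h)
    · exact hmix u hu v hv hadj h1 h2
    · exact (hmix v hv u hu hadj.symm h2 h1).symm
    · exact hc u hu v hv hadj
  · dsimp only
    split_ifs with h1
    · rfl
    · have : v ∉ S := fun h => h1 (hAD v hv h)
      rw [Equiv.swap_apply_of_ne_of_ne]
      · exact fun h => this ⟨hAX hv, Or.inl h⟩
      · exact fun h => this ⟨hAX hv, Or.inr h⟩
  · refine if_neg ?_
    rintro ⟨n, p, hp, h0, rfl⟩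
    exact hno ⟨n, p, hp, h0, hv⟩

theorem IsLink.mono {S T A B : Set V} (hST : S ⊆ T) {n : ℕ} {p : ℕ → V}
    (h : IsLink G S A B n p) : IsLink G T A B n p :=
  { h with mem := fun t ht => hST (h.mem t ht) }

/-- If every link has even length, the colour sets of `A` and `B` can be made nested. -/
theorem exists_coloring_nested {X A B : Finset V} (hAX : A ⊆ X)
    (hpar : ∀ n p, IsLink G (X : Set V) A B n p → Even n) (c : V → Fin N)
    (hc : ∀ u ∈ X, ∀ v ∈ X, G.Adj u v → c u ≠ c v) :
    ∃ c' : V → Fin N, (∀ u ∈ X, ∀ v ∈ X, G.Adj u v → c' u ≠ c' v) ∧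
      (A.image c').card = (A.image c).card ∧ (B.image c').card = (B.image c).card ∧
      (A.image c' ⊆ B.image c' ∨ B.image c' ⊆ A.image c') := by
  induction hk : N - (A.image c ∩ B.image c).card using Nat.strong_induction_on generalizing c with
  | _ k ih =>
    by_cases hn : A.image c ⊆ B.image c ∨ B.image c ⊆ A.image c
    · exact ⟨c, hc, rfl, rfl, hn⟩
    simp only [not_or, Finset.not_subset] at hn
    obtain ⟨⟨i, hiA, hiB⟩, j, hjB, hjA⟩ := hn
    have hij : i ≠ j := by rintro rfl; exact hiB hjB
    obtain ⟨c', hc', hA', hB'⟩ := exists_kempe_swap (X := (X : Set V)) (A := A) (B := B)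
      (by exact_mod_cast hAX) hc i j (by
        intro hex
        obtain ⟨n, p, hp⟩ := exists_isLink hex
        have h0 : c (p 0) = i := by
          rcases (hp.mem 0 (by omega)).2 with h | h
          · exact h
          · exact absurd (h ▸ Finset.mem_image_of_mem c hp.start) hjA
        have hw : IsWalkSeq G {v | v ∈ (X : Set V) ∧ (c v = i ∨ c v = j)} n p :=
          ⟨hp.mem, fun t ht => (hp.adj t (t + 1) (by omega) ht).2 rfl⟩
        have hev := hpar n p (hp.mono fun v hv => hv.1)
        have := (hw.color_eq hc h0 n le_rfl).1 hev
        exact hiB (this ▸ Finset.mem_image_of_mem c hp.last))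
    have hA : A.image c' = (A.image c).image (Equiv.swap i j) := by
      rw [Finset.image_image]
      exact Finset.image_congr fun v hv => hA' v hv
    have hB : B.image c' = B.image c := Finset.image_congr fun v hv => hB' v hv
    have hcard : (A.image c').card = (A.image c).card := by
      rw [hA, Finset.card_image_of_injective _ (Equiv.swap i j).injective]
    have hlt : (A.image c ∩ B.image c).card < (A.image c' ∩ B.image c').card := by
      apply Finset.card_lt_card
      rw [Finset.ssubset_iff_of_subset]
      · refine ⟨j, ?_, fun h => hjA (Finset.mem_inter.1 h).1⟩
        rw [hA, hB]
        exact Finset.mem_inter.2 ⟨Finset.mem_image.2 ⟨i, hiA, by simp⟩, hjB⟩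
      · intro x hx
        obtain ⟨hxA, hxB⟩ := Finset.mem_inter.1 hx
        rw [hA, hB]
        refine Finset.mem_inter.2 ⟨Finset.mem_image.2 ⟨x, hxA, ?_⟩, hxB⟩
        exact Equiv.swap_apply_of_ne_of_ne (by rintro rfl; exact hiB hxB)
          (by rintro rfl; exact hjA hxA)
    have hle : (A.image c' ∩ B.image c').card ≤ N := by
      simpa using Finset.card_le_univ (A.image c' ∩ B.image c')
    obtain ⟨c'', h1, h2, h3, h4⟩ := ih _ (by omega) c' hc' rfl
    exact ⟨c'', h1, by rw [h2, hcard], by rw [h3, hB], h4⟩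

/-- If every link has odd length, the colour sets of `A` and `B` can be made disjoint, or else
to cover all the colours. -/
theorem exists_coloring_disjoint_or_cover {X A B : Finset V} (hAX : A ⊆ X)
    (hpar : ∀ n p, IsLink G (X : Set V) A B n p → Odd n) (c : V → Fin N)
    (hc : ∀ u ∈ X, ∀ v ∈ X, G.Adj u v → c u ≠ c v) :
    ∃ c' : V → Fin N, (∀ u ∈ X, ∀ v ∈ X, G.Adj u v → c' u ≠ c' v) ∧
      (A.image c').card = (A.image c).card ∧ (B.image c').card = (B.image c).card ∧
      ((∀ i ∈ A.image c', i ∉ B.image c') ∨ ∀ i, i ∈ A.image c' ∨ i ∈ B.image c') := by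
  induction hk : (A.image c ∩ B.image c).card using Nat.strong_induction_on generalizing c with
  | _ k ih =>
    by_cases hn : (∀ i ∈ A.image c, i ∉ B.image c) ∨ ∀ i, i ∈ A.image c ∨ i ∈ B.image c
    · exact ⟨c, hc, rfl, rfl, hn⟩
    push Not at hn
    obtain ⟨⟨i, hiA, hiB⟩, j, hjA, hjB⟩ := hn
    have hij : i ≠ j := by rintro rfl; exact hjA hiA
    obtain ⟨c', hc', hA', hB'⟩ := exists_kempe_swap (X := (X : Set V)) (A := A) (B := B)
      (by exact_mod_cast hAX) hc i j (by
        intro hex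
        obtain ⟨n, p, hp⟩ := exists_isLink hex
        have h0 : c (p 0) = i := by
          rcases (hp.mem 0 (by omega)).2 with h | h
          · exact h
          · exact absurd (h ▸ Finset.mem_image_of_mem c hp.start) hjA
        have hw : IsWalkSeq G {v | v ∈ (X : Set V) ∧ (c v = i ∨ c v = j)} n p :=
          ⟨hp.mem, fun t ht => (hp.adj t (t + 1) (by omega) ht).2 rfl⟩
        have hodd := hpar n p (hp.mono fun v hv => hv.1)
        have := (hw.color_eq hc h0 n le_rfl).2 hodd
        exact hjB (this ▸ Finset.mem_image_of_mem c hp.last))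
    have hA : A.image c' = (A.image c).image (Equiv.swap i j) := by
      rw [Finset.image_image]
      exact Finset.image_congr fun v hv => hA' v hv
    have hB : B.image c' = B.image c := Finset.image_congr fun v hv => hB' v hv
    have hcard : (A.image c').card = (A.image c).card := by
      rw [hA, Finset.card_image_of_injective _ (Equiv.swap i j).injective]
    have hlt : (A.image c' ∩ B.image c').card < (A.image c ∩ B.image c).card := by
      apply Finset.card_lt_card
      have hmem : ∀ x ∈ A.image c' ∩ B.image c', x ≠ i ∧ x ∈ A.image c ∧ x ∈ B.image c := by
        intro x hx
        rw [hA, hB] at hx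
        obtain ⟨hxA, hxB⟩ := Finset.mem_inter.1 hx
        obtain ⟨y, hy, rfl⟩ := Finset.mem_image.1 hxA
        have hyj : y ≠ j := by rintro rfl; exact hjA hy
        have hyi : y ≠ i := by
          rintro rfl
          rw [Equiv.swap_apply_left] at hxB
          exact hjB hxB
        rw [Equiv.swap_apply_of_ne_of_ne hyi hyj] at hxB ⊢
        exact ⟨hyi, hy, hxB⟩
      rw [Finset.ssubset_iff_of_subset fun x hx => Finset.mem_inter.2 (hmem x hx).2]
      exact ⟨i, Finset.mem_inter.2 ⟨hiA, hiB⟩, fun h => (hmem i h).1 rfl⟩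
    obtain ⟨c'', h1, h2, h3, h4⟩ := ih _ (by omega) c' hc' rfl
    exact ⟨c'', h1, by rw [h2, hcard], by rw [h3, hB], h4⟩

end Kempe

theorem exists_perm_of_lower {N : ℕ} (g : Fin N → ℕ) :
    ∃ f : Equiv.Perm (Fin N),
      (∀ P : Finset (Fin N), (∀ x y, g x ≤ g y → y ∈ P → x ∈ P) →
        ∀ x ∈ P, (f x : ℕ) < P.card) ∧
      ∀ Q : Finset (Fin N), (∀ x y, g x ≤ g y → x ∈ Q → y ∈ Q) →
        ∀ x ∈ Q, N ≤ f x + Q.card := by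
  have hmono := Tuple.monotone_sort g
  set s := Tuple.sort g
  refine ⟨s.symm, fun P hP x hx => ?_, fun Q hQ x hx => ?_⟩
  · have hsub : (Finset.Iic (s.symm x)).image s ⊆ P := by
      intro y hy
      obtain ⟨z, hz, rfl⟩ := Finset.mem_image.1 hy
      refine hP _ x ?_ hx
      simpa using hmono (Finset.mem_Iic.1 hz)
    have := Finset.card_le_card hsub
    rw [Finset.card_image_of_injective _ s.injective, Fin.card_Iic] at this
    omega
  · have hsub : (Finset.Ici (s.symm x)).image s ⊆ Q := by
      intro y hy
      obtain ⟨z, hz, rfl⟩ := Finset.mem_image.1 hy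
      refine hQ x _ ?_ hx
      simpa using hmono (Finset.mem_Ici.1 hz)
    have := Finset.card_le_card hsub
    rw [Finset.card_image_of_injective _ s.injective, Fin.card_Ici] at this
    omega

theorem exists_perm_of_nested {N : ℕ} {P Q : Finset (Fin N)} (h : P ⊆ Q ∨ Q ⊆ P) :
    ∃ f : Equiv.Perm (Fin N), (∀ x ∈ P, (f x : ℕ) < P.card) ∧ ∀ x ∈ Q, (f x : ℕ) < Q.card := by
  obtain ⟨f, hf, -⟩ := exists_perm_of_lower
    fun x : Fin N => (if x ∈ P then 0 else 1) + (if x ∈ Q then 0 else 1)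
  refine ⟨f, hf P ?_, hf Q ?_⟩ <;> intro x y hxy hy <;> rcases h with h | h <;>
    have hx := @h x <;> have hy := @h y <;> grind

theorem exists_perm_of_disjoint_or_cover {N : ℕ} {P Q : Finset (Fin N)}
    (h : (∀ i ∈ P, i ∉ Q) ∨ ∀ i, i ∈ P ∨ i ∈ Q) :
    ∃ f : Equiv.Perm (Fin N), (∀ x ∈ P, (f x : ℕ) < P.card) ∧ ∀ x ∈ Q, N ≤ f x + Q.card := by
  obtain ⟨f, hf, hf'⟩ := exists_perm_of_lower
    fun x : Fin N => (if x ∈ P then 0 else 1) + (if x ∈ Q then 1 else 0)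
  refine ⟨f, hf P ?_, hf' Q ?_⟩ <;> intro x y hxy hy <;> rcases h with h | h <;>
    have hx := h x <;> have hy := h y <;> grind

theorem card_le_cliqueNum_induce [Finite V] (G : SimpleGraph V) {s : Set V} {K : Finset V}
    (hK : (K : Set V) ⊆ s) (hcl : G.IsClique K) : K.card ≤ (G.induce s).cliqueNum := by
  classical
  have hcl' : (G.induce s).IsClique (K.subtype (· ∈ s) : Finset s) := by
    intro x hx y hy hxy
    exact hcl (by simpa using hx) (by simpa using hy) fun h => hxy (Subtype.ext h)
  have := hcl'.card_le_cliqueNum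
  rwa [Finset.card_subtype, Finset.filter_true_of_mem fun x hx => hK hx] at this

theorem exists_clique_card_eq_cliqueNum_induce (G : SimpleGraph V) (s : Set V) :
    ∃ K : Finset V, (K : Set V) ⊆ s ∧ G.IsClique K ∧ K.card = (G.induce s).cliqueNum := by
  classical
  obtain ⟨K, hK⟩ := (G.induce s).exists_isNClique_cliqueNum
  refine ⟨K.map (Function.Embedding.subtype _), by simp, ?_, by simp [hK.card_eq]⟩
  intro x hx y hy hxy
  obtain ⟨x', hx', rfl⟩ := Finset.mem_map.1 hx
  obtain ⟨y', hy', rfl⟩ := Finset.mem_map.1 hy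
  exact hK.isClique hx' hy' fun h => hxy (by rw [h])

section Perfection

variable [Fintype V] [DecidableEq V]

theorem MinimallyImperfect.exists_coloring {G : SimpleGraph V} (hG : MinimallyImperfect G)
    {s : Finset V} (hs : s ≠ Finset.univ) {N : ℕ}
    (hN : ∀ K : Finset V, K ⊆ s → G.IsClique K → K.card ≤ N) :
    ∃ c : V → ℕ, (∀ v ∈ s, c v < N) ∧ ∀ u ∈ s, ∀ v ∈ s, G.Adj u v → c u ≠ c v := by
  classical
  have h := hG.2 s (by simpa using hs) Set.univ
  have hle : (((G.induce (s : Set V)).induce Set.univ).cliqueNum) ≤ N := by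
    obtain ⟨K, -, hK, hcard⟩ :=
      exists_clique_card_eq_cliqueNum_induce (G.induce (s : Set V)) Set.univ
    rw [← hcard]
    refine le_trans (hK.card_le_cliqueNum) ?_
    obtain ⟨K', hK's, hK', hcard'⟩ := exists_clique_card_eq_cliqueNum_induce G (s : Set V)
    rw [← hcard']
    exact hN K' (by exact_mod_cast hK's) hK'
  have hcol : ((G.induce (s : Set V)).induce Set.univ).Colorable N := by
    rw [← chromaticNumber_le_iff_colorable, h]
    exact_mod_cast hle
  obtain ⟨C⟩ := hcol
  refine ⟨fun v => if h : v ∈ s then C ⟨⟨v, h⟩, trivial⟩ else 0, fun v hv => by simp [hv],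
    fun u hu v hv hadj => ?_⟩
  simp only [hu, hv, dif_pos]
  intro heq
  exact C.valid (v := ⟨⟨u, hu⟩, trivial⟩) (w := ⟨⟨v, hv⟩, trivial⟩) hadj (Fin.ext heq)

theorem MinimallyImperfect.exists_not_colorable {G : SimpleGraph V} (hG : MinimallyImperfect G) :
    ∃ N : ℕ, (∀ K : Finset V, G.IsClique K → K.card ≤ N) ∧
      ¬ ∃ c : V → Fin N, ∀ u v, G.Adj u v → c u ≠ c v := by
  classical
  have h1 := hG.1
  unfold IsPerfect at h1
  push Not at h1
  obtain ⟨s, hs⟩ := h1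
  have key : ∀ c : V → Fin (G.induce s).cliqueNum,
      ¬ ∀ u ∈ s, ∀ v ∈ s, G.Adj u v → c u ≠ c v := by
    intro c hc
    refine hs (le_antisymm ?_ cliqueNum_le_chromaticNumber)
    rw [chromaticNumber_le_iff_colorable]
    exact ⟨Coloring.mk (fun v => c v) fun {u v} hadj => hc u u.2 v v.2 hadj⟩
  have huniv : s = Set.univ := by
    by_contra hne
    obtain ⟨c, hc, hc'⟩ := hG.exists_coloring (s := s.toFinset) (N := (G.induce s).cliqueNum)
      (by simpa [← Set.toFinset_univ] using hne) fun K hK hcl =>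
        card_le_cliqueNum_induce G (by simpa using hK) hcl
    simp only [Set.mem_toFinset] at hc hc'
    refine hs (le_antisymm ?_ cliqueNum_le_chromaticNumber)
    rw [chromaticNumber_le_iff_colorable]
    exact ⟨Coloring.mk (fun v => ⟨c v, hc v v.2⟩) fun {u v} hadj heq =>
      hc' u u.2 v v.2 hadj (Fin.ext_iff.1 heq)⟩
  refine ⟨_, fun K hK => card_le_cliqueNum_induce G (s := s) (by simp [huniv]) hK, ?_⟩
  rintro ⟨c, hc⟩
  exact key c fun u _ v _ => hc u v

/-- Lovász's replication lemma in weighted form: if the clique bound gives a colouring of every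
induced subgraph on a subset of `T`, then it gives a multicolouring for every weight
supported on `T`. -/
theorem exists_multicoloring {G : SimpleGraph V} {T : Finset V}
    (hT : ∀ s ⊆ T, ∀ N : ℕ, (∀ K : Finset V, K ⊆ s → G.IsClique K → K.card ≤ N) →
      ∃ c : V → ℕ, (∀ v ∈ s, c v < N) ∧ ∀ u ∈ s, ∀ v ∈ s, G.Adj u v → c u ≠ c v)
    (w : V → ℕ) (hw : ∀ v, v ∉ T → w v = 0) (N : ℕ)
    (hN : ∀ K : Finset V, G.IsClique K → ∑ v ∈ K, w v ≤ N) :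
    ∃ C : V → Finset ℕ, (∀ v, (C v).card = w v) ∧ (∀ v, C v ⊆ Finset.range N) ∧
      ∀ u v, G.Adj u v → Disjoint (C u) (C v) := by
  induction hk : ∑ v, w v using Nat.strong_induction_on generalizing w N with
  | _ k ih =>
  by_cases h1 : ∀ v, w v ≤ 1
  · have hs : Finset.univ.filter (fun v => w v = 1) ⊆ T := by
      intro v hv
      by_contra hvT
      simp [hw v hvT] at hv
    obtain ⟨c, hc, hc'⟩ := hT _ hs N (by
      intro K hK hcl
      refine le_trans (le_of_eq ?_) (hN K hcl)
      rw [Finset.card_eq_sum_ones]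
      exact Finset.sum_congr rfl fun v hv => (by simpa using hK hv : w v = 1).symm)
    simp only [Finset.mem_filter, Finset.mem_univ, true_and] at hc hc'
    refine ⟨fun v => if w v = 1 then {c v} else ∅, fun v => ?_, fun v => ?_, fun u v hadj => ?_⟩
    · have := h1 v
      dsimp only
      split_ifs with h
      · simp [h]
      · simp; omega
    · dsimp only
      split_ifs with h
      · simpa using hc v h
      · simp
    · dsimp only
      split_ifs with h h' <;> simp
      exact (hc' u h v h' hadj)
  push Not at h1
  obtain ⟨x, hx⟩ := h1
  have hxT : x ∈ T := by
    by_contra h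
    have := hw x h
    omega
  set w' : V → ℕ := fun v => if v = x then w v - 1 else w v with hw'def
  have hw'' : ∀ v, w v = w' v + if v = x then 1 else 0 := by
    intro v
    simp only [hw'def]
    split_ifs with h
    · subst h; omega
    · rfl
  have hsum : ∀ K : Finset V, ∑ v ∈ K, w v = ∑ v ∈ K, w' v + if x ∈ K then 1 else 0 := by
    intro K
    rw [Finset.sum_congr rfl fun v _ => hw'' v, Finset.sum_add_distrib, Finset.sum_ite_eq']
  have htot := hsum Finset.univ
  rw [if_pos (Finset.mem_univ _)] at htot
  have hw'T : ∀ v, v ∉ T → w' v = 0 := by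
    intro v hv
    have := hw v hv
    have := hw'' v
    omega
  obtain ⟨C, hC, hCN, hCd⟩ := ih _ (by omega) w' hw'T N
    (fun K hK => by have := hN K hK; have := hsum K; omega) rfl
  obtain ⟨i, hi⟩ : (C x).Nonempty := by
    rw [← Finset.card_pos, hC]
    simp only [hw'def, if_pos]
    omega
  have hiN : i < N := by simpa using hCN x hi
  set w2 : V → ℕ := fun v => if i ∈ C v ∧ v ≠ x then w' v - 1 else w' v with hw2
  have hw2le : ∀ v, w2 v ≤ w' v := by
    intro v
    simp only [hw2]
    split_ifs <;> omega
  have hclique2 : ∀ K : Finset V, G.IsClique K → ∑ v ∈ K, w2 v ≤ N - 1 := by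
    intro K hK
    have hle : ∑ v ∈ K, w2 v ≤ ∑ v ∈ K, w' v := Finset.sum_le_sum fun v _ => hw2le v
    have hKN := hN K hK
    rw [hsum K] at hKN
    by_cases hxK : x ∈ K
    · rw [if_pos hxK] at hKN
      omega
    rw [if_neg hxK] at hKN
    by_cases hlt : ∑ v ∈ K, w' v ≤ N - 1
    · exact hle.trans hlt
    have hKN' : ∑ v ∈ K, w' v = N := by omega
    have hcard : (K.biUnion C).card = N := by
      rw [Finset.card_biUnion fun u hu v hv huv => hCd u v (hK hu hv huv)]
      exact (Finset.sum_congr rfl fun v _ => hC v).trans hKN'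
    have hall : K.biUnion C = Finset.range N :=
      Finset.eq_of_subset_of_card_le (Finset.biUnion_subset.2 fun v _ => hCN v) (by simp [hcard])
    obtain ⟨v, hvK, hiv⟩ := Finset.mem_biUnion.1 (hall ▸ Finset.mem_range.2 hiN)
    have hvx : v ≠ x := by rintro rfl; exact hxK hvK
    have : ∑ v ∈ K, w2 v < ∑ v ∈ K, w' v := by
      refine Finset.sum_lt_sum (fun v _ => hw2le v) ⟨v, hvK, ?_⟩
      have : 0 < w' v := by rw [← hC]; exact Finset.card_pos.2 ⟨i, hiv⟩
      simp only [hw2, if_pos (And.intro hiv hvx)]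
      omega
    omega
  obtain ⟨D, hD, hDN, hDd⟩ := ih (∑ v, w2 v)
    (by have : ∑ v, w2 v ≤ ∑ v, w' v := Finset.sum_le_sum fun v _ => hw2le v
        omega)
    w2 (fun v hv => by have := hw'T v hv; have := hw2le v; omega) (N - 1) hclique2 rfl
  have hnot : ∀ v, N - 1 ∉ D v := fun v h => by simpa using hDN v h
  refine ⟨fun v => if i ∈ C v then insert (N - 1) (D v) else D v, fun v => ?_, fun v => ?_,
    fun u v hadj => ?_⟩
  · dsimp only
    have hv := hw'' v
    split_ifs with h
    · rw [Finset.card_insert_of_notMem (hnot v), hD]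
      by_cases hvx : v = x
      · subst hvx
        simp [hw2] at hv ⊢
        omega
      · have : 0 < w' v := by rw [← hC]; exact Finset.card_pos.2 ⟨i, h⟩
        simp only [hvx, if_false] at hv
        simp only [hw2, h, hvx, ne_eq, not_false_eq_true, and_self, if_true]
        omega
    · have hvx : v ≠ x := by rintro rfl; exact h hi
      rw [hD, hv, if_neg hvx]
      simp [hw2, h]
  · have hsub : D v ⊆ Finset.range N := (hDN v).trans (Finset.range_mono (by omega))
    dsimp only
    split_ifs with h
    · exact Finset.insert_subset (by simp; omega) hsub
    · exact hsub
  · have hd := hDd u v hadj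
    dsimp only
    split_ifs with h h' h'
    · exact absurd h' (Finset.disjoint_left.1 (hCd u v hadj) h)
    · exact Finset.disjoint_insert_left.2 ⟨hnot v, hd⟩
    · exact Finset.disjoint_insert_right.2 ⟨hnot u, hd⟩
    · exact hd

/-- A proper colouring of one side `X` with few colours on `A` and on `B`, obtained by
replicating a vertex `p` attached to `A` and a vertex `q` attached to `B`. -/
theorem MinimallyImperfect.exists_side_coloring {G : SimpleGraph V} (hG : MinimallyImperfect G)
    {N : ℕ} (hpos : 0 < N) (hN : ∀ K : Finset V, G.IsClique K → K.card ≤ N)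
    {X A B : Finset V} (hAX : A ⊆ X) (hBX : B ⊆ X) (hAB : Disjoint A B) {p q : V}
    (hpX : p ∉ X) (hqX : q ∉ X) (hne : insert p (insert q X) ≠ Finset.univ)
    (hpA : ∀ x ∈ X, G.Adj x p ↔ x ∈ A) (hqB : ∀ x ∈ X, G.Adj x q ↔ x ∈ B) {α β : ℕ}
    (hα : ∀ K ⊆ A, G.IsClique K → K.card ≤ α) (hβ : ∀ K ⊆ B, G.IsClique K → K.card ≤ β)
    (hαN : α ≤ N) (hβN : β ≤ N) (hpq : p ≠ q) (hadj : G.Adj p q → N ≤ α + β) :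
    ∃ c : V → Fin N, (∀ u ∈ X, ∀ v ∈ X, G.Adj u v → c u ≠ c v) ∧
      (A.image c).card ≤ α ∧ (B.image c).card ≤ β := by
  set w : V → ℕ := fun v => (if v ∈ X then 1 else 0) + (if v = p then N - α else 0) +
    (if v = q then N - β else 0) with hw
  obtain ⟨C, hC, hCN, hCd⟩ := exists_multicoloring (G := G) (T := insert p (insert q X))
    (fun s hs M hM => hG.exists_coloring
      (fun h => hne (Finset.univ_subset_iff.1 (h ▸ hs))) hM) w
    (fun v hv => by
      simp only [Finset.mem_insert, not_or] at hv
      simp [hw, hv.1, hv.2.1, hv.2.2]) N (by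
    intro K hK
    have hsub : ∀ L ⊆ K, G.IsClique L := fun L hL => hK.subset (by exact_mod_cast hL)
    simp only [hw, Finset.sum_add_distrib, Finset.sum_ite_eq', Finset.sum_boole, Nat.cast_id]
    have hp' : p ∈ K → K.filter (· ∈ X) ⊆ A := by
      intro hp x hx
      obtain ⟨hxK, hxX⟩ := Finset.mem_filter.1 hx
      exact (hpA x hxX).1 (hK hxK hp (by rintro rfl; exact hpX hxX))
    have hq' : q ∈ K → K.filter (· ∈ X) ⊆ B := by
      intro hq x hx
      obtain ⟨hxK, hxX⟩ := Finset.mem_filter.1 hx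
      exact (hqB x hxX).1 (hK hxK hq (by rintro rfl; exact hqX hxX))
    have hcl := hsub _ (Finset.filter_subset (· ∈ X) K)
    have h0 := hN _ hcl
    split_ifs with hp hq hq
    · have : K.filter (· ∈ X) = ∅ := by
        rw [← Finset.subset_empty, ← Finset.disjoint_iff_inter_eq_empty.1 hAB]
        exact Finset.subset_inter (hp' hp) (hq' hq)
      have := hadj (hK hp hq hpq)
      simp_all
      omega
    · have := hα _ (hp' hp) hcl
      omega
    · have := hβ _ (hq' hq) hcl
      omega
    · omega)
  have hwX : ∀ v ∈ X, w v = 1 := by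
    intro v hv
    have h1 : v ≠ p := by rintro rfl; exact hpX hv
    have h2 : v ≠ q := by rintro rfl; exact hqX hv
    simp [hw, hv, h1, h2]
  have hone : ∀ v, ∃ i : Fin N, v ∈ X → C v = {(i : ℕ)} := by
    intro v
    by_cases hv : v ∈ X
    · obtain ⟨i, hi⟩ := Finset.card_eq_one.1 ((hC v).trans (hwX v hv))
      have : i < N := by simpa [hi] using hCN v
      exact ⟨⟨i, this⟩, fun _ => hi⟩
    · exact ⟨⟨0, hpos⟩, fun h => absurd h hv⟩
  choose c hc using hone
  have hcount : ∀ (Y : Finset V) (r : V) (γ : ℕ), Y ⊆ X → (∀ x ∈ Y, G.Adj x r) → γ ≤ N →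
      N - γ ≤ w r → (Y.image c).card ≤ γ := by
    intro Y r γ hY hr hγ hwr
    have hsub : (Y.image c).map Fin.valEmbedding ⊆ Finset.range N \ C r := by
      intro i hi
      obtain ⟨j, hj, rfl⟩ := Finset.mem_map.1 hi
      obtain ⟨v, hv, rfl⟩ := Finset.mem_image.1 hj
      have hd := hCd v r (hr v hv)
      rw [hc v (hY hv), Finset.disjoint_singleton_left] at hd
      exact Finset.mem_sdiff.2 ⟨by simp, hd⟩
    have := Finset.card_le_card hsub
    rw [Finset.card_map, Finset.card_sdiff_of_subset (hCN r), hC, Finset.card_range] at this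
    omega
  refine ⟨c, fun u hu v hv huv heq => ?_, hcount A p α hAX (fun x hx => (hpA x (hAX hx)).2 hx)
    hαN ?_, hcount B q β hBX (fun x hx => (hqB x (hBX hx)).2 hx) hβN ?_⟩
  · have := hCd u v huv
    rw [hc u hu, hc v hv, heq] at this
    simp at this
  · simp [hw, hpq, hpX]
  · simp [hw, hpq.symm, hqX]

/-- An odd hole in a minimally imperfect graph is the whole graph. -/
theorem MinimallyImperfect.iso_cycleGraph {G : SimpleGraph V} (hG : MinimallyImperfect G)
    {k : ℕ} (hk : Odd k) (hk5 : 5 ≤ k) {f : ℕ → V}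
    (hinj : ∀ i j, i < j → j < k → f i ≠ f j)
    (hadj : ∀ i j, i < j → j < k → (G.Adj (f i) (f j) ↔ j = i + 1 ∨ i = 0 ∧ j + 1 = k)) :
    Nonempty (G ≃g cycleGraph k) := by
  have huniv : (Finset.range k).image f = Finset.univ := by
    by_contra hne
    obtain ⟨c, hc, hc'⟩ := hG.exists_coloring hne (N := 2) (by
      intro K hK hcl
      by_contra hcard
      obtain ⟨L, hLK, hL⟩ := Finset.exists_subset_card_eq (show 3 ≤ K.card by omega)
      have hmem : ∀ x ∈ K, ∃ i < k, f i = x := fun x hx => by simpa using hK hx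
      have hcl' : G.IsClique L := hcl.subset (by exact_mod_cast hLK)
      obtain ⟨x, y, z, hxy, hxz, hyz, rfl⟩ := Finset.card_eq_three.1 hL
      obtain ⟨i, hi, rfl⟩ := hmem x (hLK (by simp))
      obtain ⟨j, hj, rfl⟩ := hmem y (hLK (by simp))
      obtain ⟨l, hl, rfl⟩ := hmem z (hLK (by simp))
      have h1 : G.Adj (f i) (f j) := hcl' (by simp) (by simp) hxy
      have h2 : G.Adj (f i) (f l) := hcl' (by simp) (by simp) hxz
      have h3 : G.Adj (f j) (f l) := hcl' (by simp) (by simp) hyz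
      have hgen : ∀ i j, i < k → j < k → G.Adj (f i) (f j) →
          j = i + 1 ∨ i = j + 1 ∨ (i = 0 ∧ j + 1 = k) ∨ (j = 0 ∧ i + 1 = k) := by
        intro i j hi hj h
        rcases lt_trichotomy i j with hij | rfl | hij
        · have := (hadj i j hij hj).1 h
          omega
        · exact absurd h (G.loopless.irrefl _)
        · have := (hadj j i hij hi).1 h.symm
          omega
      have := hgen i j hi hj h1
      have := hgen i l hi hl h2
      have := hgen j l hj hl h3
      omega)
    have hmem : ∀ t < k, f t ∈ (Finset.range k).image f := fun t ht =>
      Finset.mem_image_of_mem f (Finset.mem_range.2 ht)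
    have halt : ∀ t < k, (Even t → c (f t) = c (f 0)) ∧ (Odd t → c (f t) ≠ c (f 0)) := by
      intro t
      induction t with
      | zero => simp
      | succ t ih =>
        intro ht
        obtain ⟨h1, h2⟩ := ih (by omega)
        have hne' := hc' _ (hmem t (by omega)) _ (hmem (t + 1) ht)
          ((hadj t (t + 1) (by omega) ht).2 (Or.inl rfl))
        have := hc _ (hmem t (by omega))
        have := hc _ (hmem (t + 1) ht)
        have := hc _ (hmem 0 (by omega))
        grind
    have hlast := hc' _ (hmem 0 (by omega)) _ (hmem (k - 1) (by omega))
      ((hadj 0 (k - 1) (by omega) (by omega)).2 (Or.inr ⟨rfl, by omega⟩))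
    exact hlast ((halt (k - 1) (by omega)).1 (by grind)).symm
  have hbij : Function.Bijective fun i : Fin k => f i := by
    refine ⟨fun i j hij => ?_, fun v => ?_⟩
    · rcases lt_trichotomy i j with h | h | h
      · exact absurd hij (hinj i j h j.2)
      · exact h
      · exact absurd hij.symm (hinj j i h i.2)
    · obtain ⟨i, hi, rfl⟩ := Finset.mem_image.1 (huniv ▸ Finset.mem_univ v)
      exact ⟨⟨i, Finset.mem_range.1 hi⟩, rfl⟩
  have hcyc : ∀ i j : Fin k, i < j → (G.Adj (f i) (f j) ↔ (cycleGraph k).Adj i j) := by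
    intro i j hij
    rw [hadj i j hij j.2, cycleGraph_adj']
    have h1 : (i - j).val = k + i - j := by
      rw [Fin.coe_sub_iff_lt.2 hij]
    have h2 : (j - i).val = j - i := Fin.coe_sub_iff_le.2 hij.le
    rw [h1, h2]
    have := i.2
    have := j.2
    have : (i : ℕ) < j := hij
    omega
  refine ⟨RelIso.symm ⟨Equiv.ofBijective _ hbij, fun {i j} => ?_⟩⟩
  simp only [Equiv.ofBijective_apply]
  rcases lt_trichotomy i j with h | rfl | h
  · exact hcyc i j h
  · simp
  · rw [G.adj_comm, hcyc j i h, SimpleGraph.adj_comm]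

end Perfection

section TwoJoin

variable {G : SimpleGraph V}

/-- Two links on the two sides of a 2-join, of different parity, close up to an odd hole. -/
theorem MinimallyImperfect.iso_cycleGraph_of_links [Fintype V] [DecidableEq V]
    (hG : MinimallyImperfect G) {X1 X2 A1 B1 A2 B2 : Finset V} (hX : Disjoint X1 X2)
    (hAB1 : Disjoint A1 B1) (hAB2 : Disjoint A2 B2)
    (hcross : ∀ x ∈ X1, ∀ y ∈ X2, G.Adj x y ↔ ((x ∈ A1 ∧ y ∈ A2) ∨ (x ∈ B1 ∧ y ∈ B2)))
    {m n : ℕ} {p q : ℕ → V} (hp : IsLink G (X1 : Set V) A1 B1 m p)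
    (hq : IsLink G (X2 : Set V) A2 B2 n q) (hodd : Odd (m + n)) :
    ∃ k : ℕ, Odd k ∧ 5 ≤ k ∧ Nonempty (G ≃g cycleGraph k) := by
  have hm : m ≠ 0 := by
    rintro rfl
    exact Finset.disjoint_left.1 hAB1 hp.start hp.last
  have hn : n ≠ 0 := by
    rintro rfl
    exact Finset.disjoint_left.1 hAB2 hq.start hq.last
  have h5 : 5 ≤ m + n + 2 := by grind
  have hkodd : Odd (m + n + 2) := by grind
  refine ⟨m + n + 2, hkodd, h5, hG.iso_cycleGraph hkodd h5
    (f := fun i => if i ≤ m then p i else q (m + n + 1 - i)) ?_ ?_⟩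
  · intro i j hij hj
    by_cases hi : i ≤ m <;> by_cases hj' : j ≤ m
    · rw [if_pos hi, if_pos hj']
      exact hp.inj i j hij hj'
    · rw [if_pos hi, if_neg hj']
      intro h
      exact Finset.disjoint_left.1 hX (hp.mem i hi) (h ▸ hq.mem (m + n + 1 - j) (by omega))
    · omega
    · rw [if_neg hi, if_neg hj']
      exact (hq.inj _ _ (by omega) (by omega)).symm
  · intro i j hij hj
    by_cases hi : i ≤ m <;> by_cases hj' : j ≤ m
    · rw [if_pos hi, if_pos hj', hp.adj i j hij hj']
      omega
    · rw [if_pos hi, if_neg hj', hcross _ (hp.mem i hi) _ (hq.mem (m + n + 1 - j) (by omega))]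
      have h1 : p i ∈ A1 ↔ i = 0 := by
        refine ⟨fun h => ?_, fun h => h ▸ hp.start⟩
        by_contra h0
        exact hp.notMem_left i (by omega) hi h
      have h2 : p i ∈ B1 ↔ i = m := by
        refine ⟨fun h => ?_, fun h => h ▸ hp.last⟩
        by_contra h0
        exact hp.notMem_right i (by omega) h
      have h3 : q (m + n + 1 - j) ∈ A2 ↔ m + n + 1 - j = 0 := by
        refine ⟨fun h => ?_, fun h => h ▸ hq.start⟩
        by_contra h0
        exact hq.notMem_left _ (by omega) (by omega) h
      have h4 : q (m + n + 1 - j) ∈ B2 ↔ m + n + 1 - j = n := by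
        refine ⟨fun h => ?_, fun h => by rw [h]; exact hq.last⟩
        by_contra h0
        exact hq.notMem_right _ (by omega) h
      rw [h1, h2, h3, h4]
      omega
    · omega
    · rw [if_neg hi, if_neg hj', G.adj_comm, hq.adj _ _ (by omega) (by omega)]
      omega

/-- Colourings of the two sides whose colours on `A1`, `A2` and on `B1`, `B2` are separated
glue to a proper colouring. -/
theorem exists_coloring_glue [DecidableEq V] {N : ℕ} {X1 X2 A1 B1 A2 B2 : Finset V}
    (hcov : ∀ v, v ∈ X1 ∨ v ∈ X2)
    (hcross : ∀ x ∈ X1, ∀ y ∈ X2, G.Adj x y ↔ ((x ∈ A1 ∧ y ∈ A2) ∨ (x ∈ B1 ∧ y ∈ B2)))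
    {c1 c2 : V → Fin N} (h1 : ∀ u ∈ X1, ∀ v ∈ X1, G.Adj u v → c1 u ≠ c1 v)
    (h2 : ∀ u ∈ X2, ∀ v ∈ X2, G.Adj u v → c2 u ≠ c2 v)
    (hA : ∀ x ∈ A1, ∀ y ∈ A2, c1 x ≠ c2 y) (hB : ∀ x ∈ B1, ∀ y ∈ B2, c1 x ≠ c2 y) :
    ∃ c : V → Fin N, ∀ u v, G.Adj u v → c u ≠ c v := by
  have hmix : ∀ u ∈ X1, ∀ v ∈ X2, G.Adj u v → c1 u ≠ c2 v := by
    intro u hu v hv hadj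
    rcases (hcross u hu v hv).1 hadj with h | h
    · exact hA u h.1 v h.2
    · exact hB u h.1 v h.2
  refine ⟨fun v => if v ∈ X1 then c1 v else c2 v, fun u v hadj => ?_⟩
  dsimp only
  have hu := hcov u
  have hv := hcov v
  split_ifs with hu1 hv1 hv1
  · exact h1 u hu1 v hv1 hadj
  · exact hmix u hu1 v (hv.resolve_left hv1) hadj
  · exact (hmix v hv1 u (hu.resolve_left hu1) hadj.symm).symm
  · exact h2 u (hu.resolve_left hu1) v (hv.resolve_left hv1) hadj

/-- If the links on both sides have the same parity, colourings of the two sides that use few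
enough colours on `A1`, `A2`, `B1`, `B2` can be combined into a colouring of the graph. -/
theorem exists_coloring_of_parity [DecidableEq V] {N : ℕ} {X1 X2 A1 B1 A2 B2 : Finset V}
    (hA1 : A1 ⊆ X1) (hA2 : A2 ⊆ X2) (hcov : ∀ v, v ∈ X1 ∨ v ∈ X2)
    (hcross : ∀ x ∈ X1, ∀ y ∈ X2, G.Adj x y ↔ ((x ∈ A1 ∧ y ∈ A2) ∨ (x ∈ B1 ∧ y ∈ B2)))
    (hpar : ((∀ n p, IsLink G (X1 : Set V) A1 B1 n p → Even n) ∧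
        ∀ n p, IsLink G (X2 : Set V) A2 B2 n p → Even n) ∨
      ((∀ n p, IsLink G (X1 : Set V) A1 B1 n p → Odd n) ∧
        ∀ n p, IsLink G (X2 : Set V) A2 B2 n p → Odd n))
    {c1 c2 : V → Fin N} (hc1 : ∀ u ∈ X1, ∀ v ∈ X1, G.Adj u v → c1 u ≠ c1 v)
    (hc2 : ∀ u ∈ X2, ∀ v ∈ X2, G.Adj u v → c2 u ≠ c2 v)
    (hA : (A1.image c1).card + (A2.image c2).card ≤ N)
    (hB : (B1.image c1).card + (B2.image c2).card ≤ N) :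
    ∃ c : V → Fin N, ∀ u v, G.Adj u v → c u ≠ c v := by
  have hglue : ∀ (d1 d2 : V → Fin N) (f1 f2 : Equiv.Perm (Fin N)),
      (∀ u ∈ X1, ∀ v ∈ X1, G.Adj u v → d1 u ≠ d1 v) →
      (∀ u ∈ X2, ∀ v ∈ X2, G.Adj u v → d2 u ≠ d2 v) →
      (∀ x ∈ A1, ∀ y ∈ A2, f1 (d1 x) ≠ (f2 (d2 y)).rev) →
      (∀ x ∈ B1, ∀ y ∈ B2, f1 (d1 x) ≠ (f2 (d2 y)).rev) →
      ∃ c : V → Fin N, ∀ u v, G.Adj u v → c u ≠ c v :=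
    fun d1 d2 f1 f2 hd1 hd2 => exists_coloring_glue hcov hcross
      (fun u hu v hv hadj h => hd1 u hu v hv hadj (f1.injective h))
      (fun u hu v hv hadj h => hd2 u hu v hv hadj (f2.injective (Fin.rev_injective h)))
  rcases hpar with ⟨hpar1, hpar2⟩ | ⟨hpar1, hpar2⟩
  · obtain ⟨d1, hd1, hd1A, hd1B, h1⟩ := exists_coloring_nested hA1 hpar1 c1 hc1
    obtain ⟨d2, hd2, hd2A, hd2B, h2⟩ := exists_coloring_nested hA2 hpar2 c2 hc2
    obtain ⟨f1, hf1A, hf1B⟩ := exists_perm_of_nested h1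
    obtain ⟨f2, hf2A, hf2B⟩ := exists_perm_of_nested h2
    refine hglue d1 d2 f1 f2 hd1 hd2 (fun x hx y hy h => ?_) fun x hx y hy h => ?_
    · have h1 := hf1A _ (Finset.mem_image_of_mem d1 hx)
      have h2 := hf2A _ (Finset.mem_image_of_mem d2 hy)
      rw [Fin.ext_iff, Fin.val_rev] at h
      omega
    · have h1 := hf1B _ (Finset.mem_image_of_mem d1 hx)
      have h2 := hf2B _ (Finset.mem_image_of_mem d2 hy)
      rw [Fin.ext_iff, Fin.val_rev] at h
      omega
  · obtain ⟨d1, hd1, hd1A, hd1B, h1⟩ := exists_coloring_disjoint_or_cover hA1 hpar1 c1 hc1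
    obtain ⟨d2, hd2, hd2A, hd2B, h2⟩ := exists_coloring_disjoint_or_cover hA2 hpar2 c2 hc2
    obtain ⟨f1, hf1A, hf1B⟩ := exists_perm_of_disjoint_or_cover h1
    obtain ⟨f2, hf2A, hf2B⟩ := exists_perm_of_disjoint_or_cover h2
    refine hglue d1 d2 f1 f2 hd1 hd2 (fun x hx y hy h => ?_) fun x hx y hy h => ?_
    · have h1 := hf1A _ (Finset.mem_image_of_mem d1 hx)
      have h2 := hf2A _ (Finset.mem_image_of_mem d2 hy)
      rw [Fin.ext_iff, Fin.val_rev] at h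
      omega
    · have h1 := hf1B _ (Finset.mem_image_of_mem d1 hx)
      have h2 := hf2B _ (Finset.mem_image_of_mem d2 hy)
      rw [Fin.ext_iff, Fin.val_rev] at h
      omega

theorem exists_max_clique (G : SimpleGraph V) (A : Finset V) :
    ∃ K ⊆ A, G.IsClique (K : Set V) ∧ ∀ L ⊆ A, G.IsClique (L : Set V) → L.card ≤ K.card := by
  classical
  obtain ⟨K, hK, hmax⟩ := Finset.exists_max_image
    (A.powerset.filter fun K : Finset V => G.IsClique (K : Set V)) Finset.card ⟨∅, by simp⟩
  simp only [Finset.mem_filter, Finset.mem_powerset] at hK hmax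
  exact ⟨K, hK.1, hK.2, fun L hL hcl => hmax L ⟨hL, hcl⟩⟩

theorem card_add_card_le_of_complete {N : ℕ}
    (hN : ∀ K : Finset V, G.IsClique (K : Set V) → K.card ≤ N) {A B K L : Finset V}
    (hAB : ∀ x ∈ A, ∀ y ∈ B, G.Adj x y) (hKA : K ⊆ A) (hLB : L ⊆ B)
    (hK : G.IsClique (K : Set V)) (hL : G.IsClique (L : Set V)) : K.card + L.card ≤ N := by
  classical
  have hd : Disjoint K L := Finset.disjoint_left.2 fun x hx hx' =>
    G.loopless.irrefl _ (hAB x (hKA hx) x (hLB hx'))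
  rw [← Finset.card_union_of_disjoint hd]
  refine hN _ ?_
  rw [Finset.coe_union]
  intro x hx y hy hxy
  rcases hx with hx | hx <;> rcases hy with hy | hy
  · exact hK hx hy hxy
  · exact hAB x (hKA hx) y (hLB hy)
  · exact (hAB y (hKA hy) x (hLB hx)).symm
  · exact hL hx hy hxy

/-- Two vertices `p ∈ A` and `q ∈ B`, adjacent only when `A` is complete to `B`. -/
theorem exists_nonadj_or_complete {A B : Finset V} (hA : A.Nonempty) (hB : B.Nonempty) :
    ∃ p ∈ A, ∃ q ∈ B, G.Adj p q → ∀ x ∈ A, ∀ y ∈ B, G.Adj x y := by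
  by_cases h : ∀ x ∈ A, ∀ y ∈ B, G.Adj x y
  · obtain ⟨p, hp⟩ := hA
    obtain ⟨q, hq⟩ := hB
    exact ⟨p, hp, q, hq, fun _ => h⟩
  · push Not at h
    obtain ⟨p, hp, q, hq, hpq⟩ := h
    exact ⟨p, hp, q, hq, fun h => absurd h hpq⟩

/-- Numbers `α`, `β` of colours for `A1` and `B1` leaving enough colours for `A2` and `B2`, where
`P1` and `P2` say that `A1` is complete to `B1` and `A2` is complete to `B2`. -/
theorem exists_split_sizes {N a1 b1 a2 b2 : ℕ} {P1 P2 : Prop} (ha : a1 + a2 ≤ N)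
    (hb : b1 + b2 ≤ N) (h1 : P1 → a1 + b1 ≤ N) (h2 : P2 → a2 + b2 ≤ N) :
    ∃ α β : ℕ, a1 ≤ α ∧ α + a2 ≤ N ∧ b1 ≤ β ∧ β + b2 ≤ N ∧
      (P1 → α + β ≤ N) ∧ (P2 → N ≤ α + β) := by
  by_cases hP2 : P2
  · have := h2 hP2
    by_cases hP1 : P1
    · have := h1 hP1
      refine ⟨max a1 b2, N - max a1 b2, ?_⟩
      refine ⟨?_, ?_, ?_, ?_, fun _ => ?_, fun _ => ?_⟩ <;> omega
    · refine ⟨N - a2, N - b2, ?_⟩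
      refine ⟨?_, ?_, ?_, ?_, fun h => absurd h hP1, fun _ => ?_⟩ <;> omega
  · exact ⟨a1, b1, le_rfl, ha, le_rfl, hb, h1, fun h => absurd h hP2⟩

theorem insert_insert_ne_univ [Fintype V] [DecidableEq V] {X Y : Finset V} {x y : V}
    (hXY : Disjoint X Y) (hY : 3 ≤ Y.card) : insert x (insert y X) ≠ Finset.univ := by
  intro h
  have hsub : Y ⊆ {x, y} := by
    intro v hv
    have := Finset.mem_univ v
    rw [← h] at this
    have hvX : v ∉ X := fun hvX => Finset.disjoint_left.1 hXY hvX hv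
    simpa [hvX] using this
  have := (Finset.card_le_card hsub).trans Finset.card_le_two
  omega

theorem exists_isLink_of_reachable {X A B : Finset V} (hAX : A ⊆ X) (hA : A.Nonempty)
    (h : ∀ v (hv : v ∈ X), ∃ c, ∃ hc : c ∈ X, c ∈ B ∧
      (G.induce (X : Set V)).Reachable ⟨v, hv⟩ ⟨c, hc⟩) :
    ∃ n p, IsLink G (X : Set V) A B n p := by
  obtain ⟨a, ha⟩ := hA
  obtain ⟨b, hbX, hb, hab⟩ := h a (hAX ha)
  obtain ⟨n, p, hp, h0, hn⟩ := exists_isWalkSeq_of_reachable hab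
  exact exists_isLink ⟨n, p, hp, by rw [h0]; exact ha, by rw [hn]; exact hb⟩

end TwoJoin

/-- Cornuéjols and Cunningham: a minimally imperfect graph that admits a 2-join
is an odd hole (a chordless odd cycle on at least 5 vertices). -/
theorem minimally_imperfect_two_join_is_odd_hole {V : Type} [Fintype V]
    [DecidableEq V] (G : SimpleGraph V) (hG : MinimallyImperfect G)
    (X1 X2 A1 B1 A2 B2 : Finset V) (h2j : IsTwoJoin G X1 X2 A1 B1 A2 B2) :
    ∃ k : ℕ, Odd k ∧ 5 ≤ k ∧ Nonempty (G ≃g cycleGraph k) := by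
  classical
  obtain ⟨hX, hXu, hA1, hB1, hA2, hB2, nA1, nB1, nA2, nB2, hAB1, hAB2, hcross, hX1, hX2,
    hr1, hr2, -, -⟩ := h2j
  by_contra hhole
  have hcov : ∀ v, v ∈ X1 ∨ v ∈ X2 := fun v =>
    Finset.mem_union.1 (hXu ▸ Finset.mem_univ v)
  obtain ⟨m, p, hp⟩ := exists_isLink_of_reachable hA1 nA1 fun v hv => (hr1 v hv).2
  obtain ⟨n, q, hq⟩ := exists_isLink_of_reachable hA2 nA2 fun v hv => (hr2 v hv).2
  have hpar : ∀ m p n q, IsLink G (X1 : Set V) A1 B1 m p → IsLink G (X2 : Set V) A2 B2 n q →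
      Even (m + n) := by
    intro m p n q hp hq
    rw [← Nat.not_odd_iff_even]
    exact fun hodd => hhole (hG.iso_cycleGraph_of_links hX hAB1 hAB2 hcross hp hq hodd)
  obtain ⟨N, hN, hncol⟩ := hG.exists_not_colorable
  have hpos : 0 < N := by
    obtain ⟨a, -⟩ := nA1
    exact Nat.lt_of_lt_of_le (by simp) (hN {a} (by simp))
  obtain ⟨KA1, hKA1, hclA1, hmaxA1⟩ := exists_max_clique G A1
  obtain ⟨KB1, hKB1, hclB1, hmaxB1⟩ := exists_max_clique G B1
  obtain ⟨KA2, hKA2, hclA2, hmaxA2⟩ := exists_max_clique G A2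
  obtain ⟨KB2, hKB2, hclB2, hmaxB2⟩ := exists_max_clique G B2
  have hAle := card_add_card_le_of_complete hN
    (fun x hx y hy => (hcross x (hA1 hx) y (hA2 hy)).2 (Or.inl ⟨hx, hy⟩)) hKA1 hKA2 hclA1 hclA2
  have hBle := card_add_card_le_of_complete hN
    (fun x hx y hy => (hcross x (hB1 hx) y (hB2 hy)).2 (Or.inr ⟨hx, hy⟩)) hKB1 hKB2 hclB1 hclB2
  obtain ⟨α, β, hα1, hα2, hβ1, hβ2, hcompl1, hcompl2⟩ := exists_split_sizes hAle hBle
    (fun h => card_add_card_le_of_complete (A := A1) (B := B1) hN h hKA1 hKB1 hclA1 hclB1)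
    (fun h => card_add_card_le_of_complete (A := A2) (B := B2) hN h hKA2 hKB2 hclA2 hclB2)
  obtain ⟨p2, hp2, q2, hq2, hpq2⟩ := exists_nonadj_or_complete (G := G) nA2 nB2
  obtain ⟨p1, hp1, q1, hq1, hpq1⟩ := exists_nonadj_or_complete (G := G) nA1 nB1
  have hnX1 : ∀ v ∈ X2, v ∉ X1 := fun v hv hv' => Finset.disjoint_left.1 hX hv' hv
  have hnX2 : ∀ v ∈ X1, v ∉ X2 := fun v hv hv' => Finset.disjoint_left.1 hX hv hv'
  have hA1B1 : ∀ v ∈ A1, v ∉ B1 := fun v hv => Finset.disjoint_left.1 hAB1 hv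
  have hB1A1 : ∀ v ∈ B1, v ∉ A1 := fun v hv => Finset.disjoint_right.1 hAB1 hv
  have hB2A2 : ∀ v ∈ B2, v ∉ A2 := fun v hv => Finset.disjoint_right.1 hAB2 hv
  have hA2B2 : ∀ v ∈ A2, v ∉ B2 := fun v hv => Finset.disjoint_left.1 hAB2 hv
  obtain ⟨c1, hc1, hc1A, hc1B⟩ := hG.exists_side_coloring hpos hN hA1 hB1 hAB1
    (p := p2) (q := q2) (α := α) (β := β) (hnX1 _ (hA2 hp2)) (hnX1 _ (hB2 hq2))
    (insert_insert_ne_univ hX hX2)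
    (fun x hx => by simp [hcross x hx p2 (hA2 hp2), hp2, hA2B2 p2 hp2])
    (fun x hx => by simp [hcross x hx q2 (hB2 hq2), hq2, hB2A2 q2 hq2])
    (fun K hK hcl => (hmaxA1 K hK hcl).trans hα1) (fun K hK hcl => (hmaxB1 K hK hcl).trans hβ1)
    (by omega) (by omega) (by rintro rfl; exact hA2B2 _ hp2 hq2)
    (fun h => hcompl2 (hpq2 h))
  obtain ⟨c2, hc2, hc2A, hc2B⟩ := hG.exists_side_coloring hpos hN hA2 hB2 hAB2
    (p := p1) (q := q1) (α := N - α) (β := N - β) (hnX2 _ (hA1 hp1)) (hnX2 _ (hB1 hq1))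
    (insert_insert_ne_univ hX.symm hX1)
    (fun x hx => by simp [G.adj_comm x, hcross p1 (hA1 hp1) x hx, hp1, hA1B1 p1 hp1])
    (fun x hx => by simp [G.adj_comm x, hcross q1 (hB1 hq1) x hx, hq1, hB1A1 q1 hq1])
    (fun K hK hcl => (hmaxA2 K hK hcl).trans (by omega))
    (fun K hK hcl => (hmaxB2 K hK hcl).trans (by omega))
    (by omega) (by omega) (by rintro rfl; exact hA1B1 _ hp1 hq1)
    (fun h => by have := hcompl1 (hpq1 h); omega)
  refine hncol (exists_coloring_of_parity hA1 hA2 hcov hcross ?_ hc1 hc2 (by omega) (by omega))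
  rcases Nat.even_or_odd m with hm | hm
  · have hn : Even n := (Nat.even_add.1 (hpar m p n q hp hq)).1 hm
    exact Or.inl ⟨fun m' p' hp' => (Nat.even_add.1 (hpar m' p' n q hp' hq)).2 hn,
      fun n' q' hq' => (Nat.even_add.1 (hpar m p n' q' hp hq')).1 hm⟩
  · have hn : Odd n := (Nat.even_add'.1 (hpar m p n q hp hq)).1 hm
    exact Or.inr ⟨fun m' p' hp' => (Nat.even_add'.1 (hpar m' p' n q hp' hq)).2 hn,
      fun n' q' hq' => (Nat.even_add'.1 (hpar m p n' q' hp hq')).1 hm⟩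
end

section
/- Let G be a graph with a nonnegative real weight function w on its vertices, let (X1, X2) be a 2-join of G with associated sets A1, B1, C1, A2, B2, C2, and let S be a maximum-weight stable set of G. Then exactly one of the following holds: (1) S ∩ A1 ≠ ∅, S ∩ B1 = ∅, S ∩ X1 is a maximum-weight stable set of G[A1 ∪ C1] and w(S ∩ X1) = α_AC; (2) S ∩ A1 = ∅, S ∩ B1 ≠ ∅, S ∩ X1 is a maximum-weight stable set of G[B1 ∪ C1] and w(S ∩ X1) = α_BC; (3) S ∩ A1 = ∅, S ∩ B1 = ∅, S ∩ X1 is a maximum-weight stable set of G[C1] and w(S ∩ X1) = α_C; (4) S ∩ A1 ≠ ∅, S ∩ B1 ≠ ∅, S ∩ X1 is a maximum-weight stable set of G[X1] and w(S ∩ X1) = α_X. -/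
open SimpleGraph

/-- A stable (independent) finite set of vertices. -/
def IsStableFinset {V : Type} (G : SimpleGraph V) (S : Finset V) : Prop :=
  ∀ a ∈ S, ∀ b ∈ S, ¬ G.Adj a b

/-- The maximum weight of a stable set of `G` contained in `X`. -/
noncomputable def maxStableWeight {V : Type} (G : SimpleGraph V) (w : V → ℝ)
    (X : Finset V) : ℝ :=
  sSup {r : ℝ | ∃ S : Finset V, S ⊆ X ∧ IsStableFinset G S ∧ r = ∑ v ∈ S, w v}

/-- A stable set contained in `X` that dominates every stable set contained in `X` has weight
`maxStableWeight G w X`. -/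
theorem sum_eq_maxStableWeight {V : Type} {G : SimpleGraph V} {w : V → ℝ} {X T : Finset V}
    (hTX : T ⊆ X) (hT : IsStableFinset G T)
    (hmax : ∀ S' : Finset V, S' ⊆ X → IsStableFinset G S' → ∑ v ∈ S', w v ≤ ∑ v ∈ T, w v) :
    ∑ v ∈ T, w v = maxStableWeight G w X := by
  symm
  apply IsGreatest.csSup_eq
  refine ⟨⟨T, hTX, hT, rfl⟩, ?_⟩
  rintro r ⟨S', hS'X, hS', rfl⟩
  exact hmax S' hS'X hS'

/-- If `S` is a maximum-weight stable set, then so is its trace on one side of a 2-join, among the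
stable sets of that side which meet only those of `A1` and `B1` that `S` already meets. -/
theorem IsTwoJoin.sum_le_sum_inter {V : Type} [Fintype V] [DecidableEq V]
    {G : SimpleGraph V} {w : V → ℝ} {X1 X2 A1 B1 A2 B2 : Finset V}
    (h2j : IsTwoJoin G X1 X2 A1 B1 A2 B2) {S : Finset V} (hS : IsStableFinset G S)
    (hSmax : ∀ S' : Finset V, IsStableFinset G S' → ∑ v ∈ S', w v ≤ ∑ v ∈ S, w v)
    {T : Finset V} (hTX : T ⊆ X1) (hT : IsStableFinset G T)
    (hA : (T ∩ A1).Nonempty → (S ∩ A1).Nonempty) (hB : (T ∩ B1).Nonempty → (S ∩ B1).Nonempty) :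
    ∑ v ∈ T, w v ≤ ∑ v ∈ S ∩ X1, w v := by
  obtain ⟨hdisj, hcover, hA1, hB1, -, -, -, -, -, -, -, -, hadj, -⟩ := h2j
  have hcross : ∀ x ∈ T, ∀ y ∈ S ∩ X2, ¬ G.Adj x y := by
    intro x hx y hy hxy
    obtain ⟨hyS, hyX⟩ := Finset.mem_inter.1 hy
    rcases (hadj x (hTX hx) y hyX).1 hxy with ⟨hxA, hyA⟩ | ⟨hxB, hyB⟩
    · obtain ⟨a, ha⟩ := hA ⟨x, Finset.mem_inter.2 ⟨hx, hxA⟩⟩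
      obtain ⟨haS, haA⟩ := Finset.mem_inter.1 ha
      exact hS a haS y hyS ((hadj a (hA1 haA) y hyX).2 (.inl ⟨haA, hyA⟩))
    · obtain ⟨b, hb⟩ := hB ⟨x, Finset.mem_inter.2 ⟨hx, hxB⟩⟩
      obtain ⟨hbS, hbB⟩ := Finset.mem_inter.1 hb
      exact hS b hbS y hyS ((hadj b (hB1 hbB) y hyX).2 (.inr ⟨hbB, hyB⟩))
  have hstable : IsStableFinset G (T ∪ S ∩ X2) := by
    intro a ha b hb hab
    rcases Finset.mem_union.1 ha with ha | ha <;> rcases Finset.mem_union.1 hb with hb | hb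
    · exact hT a ha b hb hab
    · exact hcross a ha b hb hab
    · exact hcross b hb a ha hab.symm
    · exact hS a (Finset.mem_inter.1 ha).1 b (Finset.mem_inter.1 hb).1 hab
  have hsplit : ∑ v ∈ S, w v = ∑ v ∈ S ∩ X1, w v + ∑ v ∈ S ∩ X2, w v := by
    rw [← Finset.sum_union (hdisj.mono Finset.inter_subset_right Finset.inter_subset_right),
      ← Finset.inter_union_distrib_left, hcover, Finset.inter_univ]
  have hle := hSmax _ hstable
  rw [Finset.sum_union (hdisj.mono hTX Finset.inter_subset_right), hsplit] at hle
  exact le_of_add_le_add_right hle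

/-- The trace of a maximum-weight stable set `S` on one side of a 2-join is a maximum-weight stable
set of any part `Y` of that side which contains it and avoids each of `A1` and `B1` that `S`
avoids. -/
theorem IsTwoJoin.inter_isMaximum {V : Type} [Fintype V] [DecidableEq V]
    {G : SimpleGraph V} {w : V → ℝ} {X1 X2 A1 B1 A2 B2 : Finset V}
    (h2j : IsTwoJoin G X1 X2 A1 B1 A2 B2) {S : Finset V} (hS : IsStableFinset G S)
    (hSmax : ∀ S' : Finset V, IsStableFinset G S' → ∑ v ∈ S', w v ≤ ∑ v ∈ S, w v)
    {Y : Finset V} (hYX : Y ⊆ X1) (hSY : S ∩ X1 ⊆ Y)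
    (hA : (Y ∩ A1).Nonempty → (S ∩ A1).Nonempty) (hB : (Y ∩ B1).Nonempty → (S ∩ B1).Nonempty) :
    (∀ S' : Finset V, S' ⊆ Y → IsStableFinset G S' → ∑ v ∈ S', w v ≤ ∑ v ∈ S ∩ X1, w v) ∧
      ∑ v ∈ S ∩ X1, w v = maxStableWeight G w Y := by
  have hmax : ∀ S' : Finset V, S' ⊆ Y → IsStableFinset G S' →
      ∑ v ∈ S', w v ≤ ∑ v ∈ S ∩ X1, w v := fun S' hS'Y hS' ↦
    h2j.sum_le_sum_inter hS hSmax (hS'Y.trans hYX) hS'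
      (fun h ↦ hA (h.mono (Finset.inter_subset_inter_right hS'Y)))
      (fun h ↦ hB (h.mono (Finset.inter_subset_inter_right hS'Y)))
  refine ⟨hmax, sum_eq_maxStableWeight hSY (fun a ha b hb ↦ ?_) hmax⟩
  exact hS a (Finset.mem_inter.1 ha).1 b (Finset.mem_inter.1 hb).1

/-- How a maximum-weight stable set interacts with a 2-join (Trotignon and
Vušković): with `C1 = X1 \ (A1 ∪ B1)`, exactly one of four cases holds; the
four cases are mutually exclusive, so they are stated as a disjunction. -/
theorem max_stable_set_two_join_cases {V : Type} [Fintype V] [DecidableEq V]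
    (G : SimpleGraph V) (w : V → ℝ) (hw : ∀ v, 0 ≤ w v)
    (X1 X2 A1 B1 A2 B2 : Finset V) (h2j : IsTwoJoin G X1 X2 A1 B1 A2 B2)
    (S : Finset V) (hS : IsStableFinset G S)
    (hSmax : ∀ S' : Finset V, IsStableFinset G S' → ∑ v ∈ S', w v ≤ ∑ v ∈ S, w v) :
    ((S ∩ A1).Nonempty ∧ S ∩ B1 = ∅ ∧
      ↑(S ∩ X1) ⊆ ↑(A1 ∪ (X1 \ (A1 ∪ B1))) ∧
      (∀ S' : Finset V, S' ⊆ A1 ∪ (X1 \ (A1 ∪ B1)) → IsStableFinset G S' →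
          ∑ v ∈ S', w v ≤ ∑ v ∈ S ∩ X1, w v) ∧
      ∑ v ∈ S ∩ X1, w v = maxStableWeight G w (A1 ∪ (X1 \ (A1 ∪ B1)))) ∨
    (S ∩ A1 = ∅ ∧ (S ∩ B1).Nonempty ∧
      ↑(S ∩ X1) ⊆ ↑(B1 ∪ (X1 \ (A1 ∪ B1))) ∧
      (∀ S' : Finset V, S' ⊆ B1 ∪ (X1 \ (A1 ∪ B1)) → IsStableFinset G S' →
          ∑ v ∈ S', w v ≤ ∑ v ∈ S ∩ X1, w v) ∧
      ∑ v ∈ S ∩ X1, w v = maxStableWeight G w (B1 ∪ (X1 \ (A1 ∪ B1)))) ∨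
    (S ∩ A1 = ∅ ∧ S ∩ B1 = ∅ ∧
      ↑(S ∩ X1) ⊆ ↑(X1 \ (A1 ∪ B1)) ∧
      (∀ S' : Finset V, S' ⊆ X1 \ (A1 ∪ B1) → IsStableFinset G S' →
          ∑ v ∈ S', w v ≤ ∑ v ∈ S ∩ X1, w v) ∧
      ∑ v ∈ S ∩ X1, w v = maxStableWeight G w (X1 \ (A1 ∪ B1))) ∨
    ((S ∩ A1).Nonempty ∧ (S ∩ B1).Nonempty ∧
      (∀ S' : Finset V, S' ⊆ X1 → IsStableFinset G S' →
          ∑ v ∈ S', w v ≤ ∑ v ∈ S ∩ X1, w v) ∧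
      ∑ v ∈ S ∩ X1, w v = maxStableWeight G w X1) := by
  have ⟨_, _, hA1, hB1, _, _, _, _, _, _, hAB, _⟩ := h2j
  rw [Finset.disjoint_left] at hAB
  rcases (S ∩ A1).eq_empty_or_nonempty with hA | hA <;>
    rcases (S ∩ B1).eq_empty_or_nonempty with hB | hB
  · have hsub : S ∩ X1 ⊆ X1 \ (A1 ∪ B1) := by
      intro x hx
      have hxA : x ∉ S ∩ A1 := by simp [hA]
      have hxB : x ∉ S ∩ B1 := by simp [hB]
      grind
    refine .inr <| .inr <| .inl ⟨hA, hB, hsub,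
      h2j.inter_isMaximum hS hSmax (by grind) hsub ?_ ?_⟩ <;>
    · rintro ⟨x, hx⟩
      grind
  · have hsub : S ∩ X1 ⊆ B1 ∪ (X1 \ (A1 ∪ B1)) := by
      intro x hx
      have hxA : x ∉ S ∩ A1 := by simp [hA]
      grind
    refine .inr <| .inl ⟨hA, hB, hsub,
      h2j.inter_isMaximum hS hSmax (by grind) hsub ?_ fun _ ↦ hB⟩
    rintro ⟨x, hx⟩
    grind
  · have hsub : S ∩ X1 ⊆ A1 ∪ (X1 \ (A1 ∪ B1)) := by
      intro x hx
      have hxB : x ∉ S ∩ B1 := by simp [hB]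
      grind
    refine .inl ⟨hA, hB, hsub,
      h2j.inter_isMaximum hS hSmax (by grind) hsub (fun _ ↦ hA) ?_⟩
    rintro ⟨x, hx⟩
    grind
  · exact .inr <| .inr <| .inr ⟨hA, hB, h2j.inter_isMaximum hS hSmax Finset.Subset.rfl
      Finset.inter_subset_right (fun _ ↦ hA) fun _ ↦ hB⟩
end
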